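/- The eigenvalues of the two-site Bose-Hubbard Hamiltonian satisfy the attractive-repulsive symmetry: if E_0^{(r)} ≤ ... ≤ E_N^{(r)} are the eigenvalues of H(J,U) with U > 0, and E_0^{(a)} ≤ ... ≤ E_N^{(a)} are the eigenvalues of H(J,−U), then E_k^{(r)} − E_0^{(r)} = E_N^{(a)} − E_{N−k}^{(a)} for all 0 ≤ k ≤ N. -/

import Mathlib

open scoped BigOperators
noncomputable section

/-- Two-mode bosonic Fock space: coefficients over number basis `|n₁,n₂⟩`. -/
abbrev Fock : Type := (ℕ × ℕ) →₀ ℂ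

/-- Annihilation operator of mode 1: `a₁ |n₁,n₂⟩ = √n₁ |n₁-1,n₂⟩`. -/
def a1 : Module.End ℂ Fock :=
  Finsupp.lsum ℂ fun m => (Real.sqrt m.1 : ℂ) • Finsupp.lsingle (m.1 - 1, m.2)

/-- Annihilation operator of mode 2. -/
def a2 : Module.End ℂ Fock :=
  Finsupp.lsum ℂ fun m => (Real.sqrt m.2 : ℂ) • Finsupp.lsingle (m.1, m.2 - 1)

/-- Creation operator of mode 1: `a₁† |n₁,n₂⟩ = √(n₁+1) |n₁+1,n₂⟩`. -/
def a1d : Module.End ℂ Fock :=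
  Finsupp.lsum ℂ fun m => (Real.sqrt (m.1 + 1) : ℂ) • Finsupp.lsingle (m.1 + 1, m.2)

/-- Creation operator of mode 2. -/
def a2d : Module.End ℂ Fock :=
  Finsupp.lsum ℂ fun m => (Real.sqrt (m.2 + 1) : ℂ) • Finsupp.lsingle (m.1, m.2 + 1)

/-- Pseudo-spin operators. -/
def Jx : Module.End ℂ Fock := (2 : ℂ)⁻¹ • (a1d * a2 + a2d * a1)
def Jy : Module.End ℂ Fock := (2 * Complex.I)⁻¹ • (a1d * a2 - a2d * a1)
def Jz : Module.End ℂ Fock := (2 : ℂ)⁻¹ • (a1d * a1 - a2d * a2)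

/-- Total number operator. -/
def numOp : Module.End ℂ Fock := a1d * a1 + a2d * a2

/-- Vacuum state `|0,0⟩`. -/
def vacuum : Fock := Finsupp.single (0, 0) 1

/-- Inner product on the Fock space (antilinear in the first argument). -/
def finner (f g : Fock) : ℂ := f.sum fun m c => (starRingEnd ℂ) c * g m

/-- Spin coherent state `|Ψ^N_{θ,φ}⟩`. -/
def coherent (N : ℕ) (θ φ : ℝ) : Fock :=
  ((Real.sqrt N.factorial : ℂ))⁻¹ •
    ((((Real.cos (θ / 2) : ℂ)) • a1d
        + (Complex.exp (Complex.I * φ) * (Real.sin (θ / 2) : ℂ)) • a2d) ^ N) vacuum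
/-- The spin form of the Bose-Hubbard Hamiltonian, `H(J,U) = -2J Jx + U Jz²`. -/
def Hspin (J U : ℝ) : Module.End ℂ Fock :=
  (-(2 * J) : ℂ) • Jx + (U : ℂ) • (Jz ^ 2)

/-- Parity of mode 1. -/
def parity1 : Module.End ℂ Fock :=
  Finsupp.lsum ℂ fun m => ((-1 : ℂ) ^ m.1) • Finsupp.lsingle m

lemma parity1_single (m : ℕ × ℕ) (c : ℂ) :
    parity1 (Finsupp.single m c) = Finsupp.single m ((-1 : ℂ) ^ m.1 * c) := by
  simp [parity1]

lemma a1_single (m : ℕ × ℕ) (c : ℂ) :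
    a1 (Finsupp.single m c) = Finsupp.single (m.1 - 1, m.2) ((Real.sqrt m.1 : ℂ) * c) := by
  simp [a1]

lemma a2_single (m : ℕ × ℕ) (c : ℂ) :
    a2 (Finsupp.single m c) = Finsupp.single (m.1, m.2 - 1) ((Real.sqrt m.2 : ℂ) * c) := by
  simp [a2]

lemma a1d_single (m : ℕ × ℕ) (c : ℂ) :
    a1d (Finsupp.single m c)
      = Finsupp.single (m.1 + 1, m.2) ((Real.sqrt (m.1 + 1) : ℂ) * c) := by
  simp [a1d]

lemma a2d_single (m : ℕ × ℕ) (c : ℂ) :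
    a2d (Finsupp.single m c)
      = Finsupp.single (m.1, m.2 + 1) ((Real.sqrt (m.2 + 1) : ℂ) * c) := by
  simp [a2d]

lemma parity1_a1 : parity1 * a1 = (-1 : ℂ) • (a1 * parity1) := by
  apply Finsupp.lhom_ext
  rintro ⟨a, b⟩ c
  rw [LinearMap.smul_apply, Module.End.mul_apply, Module.End.mul_apply, a1_single,
    parity1_single, parity1_single, a1_single, Finsupp.smul_single]
  rcases a with _ | a
  · simp
  · congr 1
    simp only [Nat.add_sub_cancel, smul_eq_mul]
    ring

lemma parity1_a1d : parity1 * a1d = (-1 : ℂ) • (a1d * parity1) := by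
  apply Finsupp.lhom_ext
  rintro ⟨a, b⟩ c
  rw [LinearMap.smul_apply, Module.End.mul_apply, Module.End.mul_apply, a1d_single,
    parity1_single, parity1_single, a1d_single, Finsupp.smul_single, smul_eq_mul]
  congr 1
  ring

lemma parity1_a2 : parity1 * a2 = a2 * parity1 := by
  apply Finsupp.lhom_ext
  rintro ⟨a, b⟩ c
  rw [Module.End.mul_apply, Module.End.mul_apply, a2_single,
    parity1_single, parity1_single, a2_single]
  congr 1
  ring

lemma parity1_a2d : parity1 * a2d = a2d * parity1 := by
  apply Finsupp.lhom_ext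
  rintro ⟨a, b⟩ c
  rw [Module.End.mul_apply, Module.End.mul_apply, a2d_single,
    parity1_single, parity1_single, a2d_single]
  congr 1
  ring

lemma parity1_sq : parity1 * parity1 = 1 := by
  apply Finsupp.lhom_ext
  rintro ⟨a, b⟩ c
  rw [Module.End.mul_apply, parity1_single, parity1_single, Module.End.one_apply,
    ← mul_assoc, ← mul_pow]
  simp

lemma ring_anti_anti {R : Type*} [Semiring R] [Algebra ℂ R] (p a b : R)
    (ha : p * a = (-1 : ℂ) • (a * p))
    (hb : p * b = (-1 : ℂ) • (b * p)) : p * (a * b) = (a * b) * p := by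
  rw [← mul_assoc, ha, smul_mul_assoc, mul_assoc, hb, mul_smul_comm, smul_smul, mul_assoc]
  simp

lemma ring_anti_comm {R : Type*} [Semiring R] [Algebra ℂ R] (p a b : R)
    (ha : p * a = (-1 : ℂ) • (a * p))
    (hb : p * b = b * p) : p * (a * b) = (-1 : ℂ) • ((a * b) * p) := by
  rw [← mul_assoc, ha, smul_mul_assoc, mul_assoc, hb, mul_assoc]

lemma ring_comm_anti {R : Type*} [Semiring R] [Algebra ℂ R] (p a b : R)
    (ha : p * a = a * p)
    (hb : p * b = (-1 : ℂ) • (b * p)) : p * (a * b) = (-1 : ℂ) • ((a * b) * p) := by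
  rw [← mul_assoc, ha, mul_assoc, hb, mul_smul_comm, mul_assoc]

lemma parity1_a1d_a1 : parity1 * (a1d * a1) = (a1d * a1) * parity1 := 
  ring_anti_anti _ _ _ parity1_a1d parity1_a1

lemma parity1_a2d_a2 : parity1 * (a2d * a2) = (a2d * a2) * parity1 := by
  rw [← mul_assoc, parity1_a2d, mul_assoc, parity1_a2, mul_assoc]

lemma parity1_a1d_a2 : parity1 * (a1d * a2) = (-1 : ℂ) • ((a1d * a2) * parity1) := 
  ring_anti_comm _ _ _ parity1_a1d parity1_a2

lemma parity1_a2d_a1 : parity1 * (a2d * a1) = (-1 : ℂ) • ((a2d * a1) * parity1) := 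
  ring_comm_anti _ _ _ parity1_a2d parity1_a1

lemma parity1_numOp : parity1 * numOp = numOp * parity1 := by
  rw [numOp, mul_add, add_mul, parity1_a1d_a1, parity1_a2d_a2]

lemma parity1_Jx : parity1 * Jx = (-1 : ℂ) • (Jx * parity1) := by
  rw [Jx, mul_smul_comm, smul_mul_assoc, mul_add, add_mul, parity1_a1d_a2, parity1_a2d_a1,
    ← smul_add, smul_comm]

lemma parity1_Jz : parity1 * Jz = Jz * parity1 := by
  rw [Jz, mul_smul_comm, smul_mul_assoc]
  congr 1
  apply LinearMap.ext
  intro f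
  have h1 := LinearMap.congr_fun parity1_a1d_a1 f
  have h2 := LinearMap.congr_fun parity1_a2d_a2 f
  simp only [Module.End.mul_apply] at h1 h2
  simp only [Module.End.mul_apply, LinearMap.sub_apply, map_sub, h1, h2]

lemma parity1_Hspin (J U : ℝ) :
    Hspin J U * parity1 = -(parity1 * Hspin J (-U)) := by
  have h2 : parity1 * Jz ^ 2 = Jz ^ 2 * parity1 := by
    rw [pow_two, ← mul_assoc, parity1_Jz, mul_assoc, parity1_Jz, mul_assoc]
  rw [Hspin, Hspin, mul_add, add_mul, mul_smul_comm, mul_smul_comm, smul_mul_assoc,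
    smul_mul_assoc, h2, parity1_Jx]
  push_cast
  module

lemma numOp_single (m : ℕ × ℕ) (c : ℂ) :
    numOp (Finsupp.single m c) = Finsupp.single m (((m.1 : ℂ) + m.2) * c) := by
  have key : ∀ n : ℕ, (Real.sqrt ((n : ℝ) + 1) : ℂ) * (Real.sqrt ((n : ℝ) + 1) : ℂ)
      = (n : ℂ) + 1 := by
    intro n
    rw [← Complex.ofReal_mul, Real.mul_self_sqrt (by positivity)]
    push_cast; rfl
  have h1 : a1d (a1 (Finsupp.single m c)) = Finsupp.single m ((m.1 : ℂ) * c) := by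
    rcases m with ⟨_ | a, b⟩
    · simp [a1_single]
    · rw [a1_single, a1d_single, ← mul_assoc]
      simp only [Nat.add_sub_cancel]
      push_cast
      rw [key]
  have h2 : a2d (a2 (Finsupp.single m c)) = Finsupp.single m ((m.2 : ℂ) * c) := by
    rcases m with ⟨a, _ | b⟩
    · simp [a2_single]
    · rw [a2_single, a2d_single, ← mul_assoc]
      simp only [Nat.add_sub_cancel]
      push_cast
      rw [key]
  rw [numOp, LinearMap.add_apply, Module.End.mul_apply, Module.End.mul_apply, h1, h2,
    ← Finsupp.single_add, add_mul]

lemma numOp_apply (f : Fock) (m : ℕ × ℕ) : numOp f m = ((m.1 : ℂ) + m.2) * f m := by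
  induction f using Finsupp.induction_linear with
  | zero => simp
  | add f g hf hg => rw [map_add, Finsupp.add_apply, hf, hg, Finsupp.add_apply, mul_add]
  | single n c =>
    rw [numOp_single]
    by_cases h : n = m
    · subst h; simp
    · simp [Finsupp.single_eq_of_ne' h]

/-- The span of the `N`-particle number states. -/
def sectorN (N : ℕ) : Submodule ℂ Fock :=
  Submodule.span ℂ (Set.range fun i : Fin (N + 1) =>
    (Finsupp.single ((i : ℕ), N - (i : ℕ)) (1 : ℂ) : Fock))

instance sectorN_fin (N : ℕ) : FiniteDimensional ℂ (sectorN N) :=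
  FiniteDimensional.span_of_finite ℂ (Set.finite_range _)

lemma sectorN_finrank (N : ℕ) : Module.finrank ℂ (sectorN N) ≤ N + 1 := by
  have := finrank_range_le_card (R := ℂ) (fun i : Fin (N + 1) =>
    (Finsupp.single ((i : ℕ), N - (i : ℕ)) (1 : ℂ) : Fock))
  rw [Fintype.card_fin] at this
  exact this

lemma mem_sectorN (N : ℕ) (f : Fock) (hf : numOp f = (N : ℂ) • f) : f ∈ sectorN N := by
  rw [← Finsupp.sum_single f]
  refine Submodule.sum_mem _ fun m hm => ?_
  have h := DFunLike.congr_fun hf m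
  rw [numOp_apply, Finsupp.smul_apply, smul_eq_mul] at h
  have h3 : (m.1 : ℂ) + m.2 = N := mul_right_cancel₀ (Finsupp.mem_support_iff.mp hm) h
  have h4 : m.1 + m.2 = N := by exact_mod_cast h3
  have h5 : Finsupp.single m (f m)
      = f m • (Finsupp.single m (1 : ℂ) : Fock) := by simp
  simp only [h5]
  refine Submodule.smul_mem _ _ (Submodule.subset_span ⟨⟨m.1, by omega⟩, ?_⟩)
  have h6 : ((m.1, N - m.1) : ℕ × ℕ) = m := by
    ext
    · rfl
    · simp; omega
  simp only [h6]

lemma eig_le (N : ℕ) (T : Module.End ℂ Fock)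
    (E F : Fin (N + 1) → ℝ) (v w : Fin (N + 1) → Fock)
    (hE : Monotone E) (hF : Monotone F)
    (hv : ∀ k, v k ∈ sectorN N ∧ T (v k) = (E k : ℂ) • v k)
    (hw : ∀ k, w k ∈ sectorN N ∧ T (w k) = (F k : ℂ) • w k)
    (hiv : LinearIndependent ℂ v) (hiw : LinearIndependent ℂ w) (k : Fin (N + 1)) :
    F k ≤ E k := by
  by_contra! hlt
  let A : Submodule ℂ Fock := Submodule.span ℂ (Set.range fun i : Set.Iic k => v i)
  let B : Submodule ℂ Fock := Submodule.span ℂ (Set.range fun i : Set.Ici k => w i)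
  have hA : A ≤ sectorN N := by
    rw [Submodule.span_le]; rintro _ ⟨i, rfl⟩; exact (hv i).1
  have hB : B ≤ sectorN N := by
    rw [Submodule.span_le]; rintro _ ⟨i, rfl⟩; exact (hw i).1
  have fA : Module.finrank ℂ A = k + 1 := by
    have := finrank_span_eq_card (hiv.comp (fun i : Set.Iic k => (i : Fin (N + 1)))
      Subtype.val_injective)
    refine this.trans ?_
    rw [Fintype.card_eq_nat_card, Nat.card_coe_set_eq]
    simp [Set.ncard_eq_toFinset_card']
  have fB : Module.finrank ℂ B = N + 1 - k := by
    have := finrank_span_eq_card (hiw.comp (fun i : Set.Ici k => (i : Fin (N + 1)))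
      Subtype.val_injective)
    refine this.trans ?_
    rw [Fintype.card_eq_nat_card, Nat.card_coe_set_eq]
    simp [Set.ncard_eq_toFinset_card']
  let S : Set ℂ := {z | z.re ≤ E k}
  let S' : Set ℂ := {z | F k ≤ z.re}
  have hSS : Disjoint S S' := by
    rw [Set.disjoint_left]
    intro z hz hz'
    exact absurd (le_trans hz' hz) (not_le.mpr hlt)
  have hA' : A ≤ ⨆ z ∈ S, T.eigenspace z := by
    rw [Submodule.span_le]; rintro _ ⟨i, rfl⟩
    have hm : ((E i : ℝ) : ℂ) ∈ S := by
      change E i ≤ E k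
      exact hE i.2
    exact (le_iSup₂_of_le (f := fun z (_ : z ∈ S) => T.eigenspace z) _ hm le_rfl)
      (Module.End.mem_eigenspace_iff.mpr (hv i).2)
  have hB' : B ≤ ⨆ z ∈ S', T.eigenspace z := by
    rw [Submodule.span_le]; rintro _ ⟨i, rfl⟩
    have hm : ((F i : ℝ) : ℂ) ∈ S' := by
      change F k ≤ F i
      exact hF i.2
    exact (le_iSup₂_of_le (f := fun z (_ : z ∈ S') => T.eigenspace z) _ hm le_rfl)
      (Module.End.mem_eigenspace_iff.mpr (hw i).2)
  have hd : Disjoint A B :=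
    (T.eigenspaces_iSupIndep.disjoint_biSup_biSup hSS).mono hA' hB'
  have : FiniteDimensional ℂ A := Submodule.finiteDimensional_of_le hA
  have : FiniteDimensional ℂ B := Submodule.finiteDimensional_of_le hB
  have h1 := Submodule.finrank_sup_add_finrank_inf_eq A B
  rw [hd.eq_bot, finrank_bot, fA, fB] at h1
  have h2 := Submodule.finrank_mono (sup_le hA hB)
  have h3 := sectorN_finrank N
  have := k.2
  omega

/-- attractive–repulsive spectral symmetry.  If `Er` (resp. `Ea`)
lists, in increasing order, the eigenvalues of `H(J,U)` (resp. `H(J,-U)`)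
on the (N+1)-dimensional N-particle subspace, witnessed by linearly
independent eigenvectors lying in that subspace, then
`E_k^r − E_0^r = E_N^a − E_{N−k}^a`. -/
theorem attractive_repulsive_symmetry (J U : ℝ) (hU : 0 < U) (N : ℕ)
    (Er Ea : Fin (N + 1) → ℝ) (vr va : Fin (N + 1) → Fock)
    (hEr : Monotone Er) (hEa : Monotone Ea)
    (hvr : ∀ k, vr k ≠ 0 ∧ numOp (vr k) = (N : ℂ) • vr k ∧
      Hspin J U (vr k) = (Er k : ℂ) • vr k)
    (hva : ∀ k, va k ≠ 0 ∧ numOp (va k) = (N : ℂ) • va k ∧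
      Hspin J (-U) (va k) = (Ea k : ℂ) • va k)
    (hir : LinearIndependent ℂ vr) (hia : LinearIndependent ℂ va) :
    ∀ k : Fin (N + 1), Er k - Er 0 = Ea (Fin.last N) - Ea k.rev := by
  have hP : ∀ f, parity1 (parity1 f) = f := fun f => by
    rw [← Module.End.mul_apply, parity1_sq, Module.End.one_apply]
  have hinj : LinearMap.ker parity1 = ⊥ :=
    LinearMap.ker_eq_bot.mpr (Function.LeftInverse.injective hP)
  let w : Fin (N + 1) → Fock := fun k => parity1 (va k.rev)
  let F : Fin (N + 1) → ℝ := fun k => -Ea k.rev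
  have hF : Monotone F := fun i j hij => neg_le_neg (hEa (Fin.rev_le_rev.mpr hij))
  have hw : ∀ k, w k ∈ sectorN N ∧ Hspin J U (w k) = (F k : ℂ) • w k := by
    intro k
    obtain ⟨_, h1, h2⟩ := hva k.rev
    refine ⟨mem_sectorN _ _ ?_, ?_⟩
    · change numOp (parity1 _) = _ • parity1 _
      rw [← Module.End.mul_apply, ← parity1_numOp, Module.End.mul_apply, h1, map_smul]
    · change Hspin J U (parity1 _) = _ • parity1 _
      rw [← Module.End.mul_apply, parity1_Hspin, LinearMap.neg_apply, Module.End.mul_apply,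
        h2, map_smul]
      simp [F]
  have hiw : LinearIndependent ℂ w :=
    (hia.map' parity1 hinj).comp Fin.rev Fin.rev_injective
  have hv : ∀ k, vr k ∈ sectorN N ∧ Hspin J U (vr k) = (Er k : ℂ) • vr k :=
    fun k => ⟨mem_sectorN _ _ (hvr k).2.1, (hvr k).2.2⟩
  have heq : ∀ k, Er k = -Ea k.rev := fun k => le_antisymm
    (eig_le N _ F Er w vr hF hEr hw hv hiw hir k)
    (eig_le N _ Er F vr w hEr hF hv hw hir hiw k)
  intro k
  rw [heq k, heq 0, Fin.rev_zero]
  ring
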